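/- arXiv:2601.00957 — 3 statements merged into one kernel-verified Lean document; each statement's English description precedes it below -/
import Mathlib

section
/- The fixing numbers of the indecomposable non-split unigraphs are as follows: Fix(C_5) = 2; Fix(mK_2) = m for m ≥ 2; Fix(U_2(m,ℓ)) = m + ℓ − 1 for m ≥ 1 and ℓ ≥ 2; and Fix(U_3(m)) = m + 1 for m ≥ 1. -/
namespace Tysh

open SimpleGraph

variable {V : Type}

/-- A set of vertices is independent (stable). -/
def IsIndep (G : SimpleGraph V) (s : Set V) : Prop :=
  ∀ ⦃u⦄, u ∈ s → ∀ ⦃v⦄, v ∈ s → u ≠ v → ¬ G.Adj u v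

/-- `(A, B)` is a KS-partition of `G`: `A` induces a clique, `B` an independent set,
and they partition the vertex set. -/
def IsKSPartition (G : SimpleGraph V) (A B : Set V) : Prop :=
  G.IsClique A ∧ IsIndep G B ∧ A ∪ B = Set.univ ∧ Disjoint A B

/-- A split graph is one admitting a KS-partition. -/
def IsSplit (G : SimpleGraph V) : Prop := ∃ A B, IsKSPartition G A B

/-- Independence number. -/
noncomputable def indepNum (G : SimpleGraph V) : ℕ := Gᶜ.cliqueNum

/-- `G` is decomposable: its vertices can be partitioned into `A ∪ B` (a nonempty split
graph with KS-partition `(A,B)`) and a nonempty part `W`, with all `A`–`W` edges present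
and no `B`–`W` edges; i.e. `G` is (isomorphic to) the composition `(G[A∪B],A,B) ∘ G[W]`. -/
def Decomposable (G : SimpleGraph V) : Prop :=
  ∃ A B W : Set V,
    (A ∪ B) ∪ W = Set.univ ∧ Disjoint A B ∧ Disjoint (A ∪ B) W ∧
    (A ∪ B).Nonempty ∧ W.Nonempty ∧
    G.IsClique A ∧ IsIndep G B ∧
    (∀ a ∈ A, ∀ w ∈ W, G.Adj a w) ∧
    (∀ b ∈ B, ∀ w ∈ W, ¬ G.Adj b w)

/-- The composition `(G,A,B) ∘ H` of a split graph `G` (with clique part `A`)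
with a graph `H`. -/
def comp {α β : Type} (G : SimpleGraph α) (A : Set α) (H : SimpleGraph β) :
    SimpleGraph (α ⊕ β) :=
  SimpleGraph.fromRel (fun x y =>
    match x, y with
    | .inl a, .inl a' => G.Adj a a'
    | .inr b, .inr b' => H.Adj b b'
    | .inl a, .inr _ => a ∈ A
    | .inr _, .inl _ => False)

/-- The iterated composition `(G_k,A_k,B_k) ∘ ⋯ ∘ (G_1,A_1,B_1) ∘ G_0`
(component `0` is `G_0`; the clique part `A i` of component `i` is joined to
all components with smaller index). -/
def iterComp {k : ℕ} {Vi : Fin (k+1) → Type} (Gi : ∀ i, SimpleGraph (Vi i))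
    (A : ∀ i, Set (Vi i)) : SimpleGraph (Σ i, Vi i) :=
  SimpleGraph.fromRel (fun x y =>
    (∃ h : x.1 = y.1, (Gi y.1).Adj (h ▸ x.2) y.2) ∨ (y.1 < x.1 ∧ x.2 ∈ A x.1))

/-- The multiset of vertex degrees of a finite graph. -/
noncomputable def degMultiset {V : Type} [Fintype V] (G : SimpleGraph V) : Multiset ℕ :=
  Finset.univ.val.map fun v => (G.neighborSet v).ncard

/-- A unigraph is a graph determined up to isomorphism by its degree sequence. -/
def Unigraph {V : Type} [Fintype V] (G : SimpleGraph V) : Prop :=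
  ∀ (W : Type) [Fintype W] (H : SimpleGraph W),
    degMultiset G = degMultiset H → Nonempty (G ≃g H)


/-- The 5-cycle. -/
def C5 : SimpleGraph (ZMod 5) := SimpleGraph.fromRel (fun x y => y = x + 1)

/-- `m` disjoint copies of `K₂`. -/
def mK2 (m : ℕ) : SimpleGraph (Fin m × Fin 2) := SimpleGraph.fromRel (fun p q => p.1 = q.1)

/-- `U₂(m,ℓ)`: disjoint union of `m K₂` and the star `K_{1,ℓ}` (center `Sum.inr none`). -/
def U2 (m ℓ : ℕ) : SimpleGraph ((Fin m × Fin 2) ⊕ Option (Fin ℓ)) :=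
  SimpleGraph.fromRel (fun x y =>
    match x, y with
    | .inl p, .inl q => p.1 = q.1
    | .inr a, .inr _ => a = none
    | _, _ => False)

/-- `U₃(m)`: a center vertex (`none`) joined to all vertices of `m K₂` and to the two
endpoints of a path `P₃`. -/
def U3 (m : ℕ) : SimpleGraph (Option ((Fin m × Fin 2) ⊕ Fin 3)) :=
  SimpleGraph.fromRel (fun x y =>
    match x, y with
    | some (.inl p), some (.inl q) => p.1 = q.1
    | some (.inr i), some (.inr j) => (j : ℕ) = (i : ℕ) + 1
    | none, some (.inl _) => True
    | none, some (.inr i) => i = 0 ∨ i = 2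
    | _, _ => False)

/-- `S(p,q)`: `q` copies of the star `K_{1,p}` with the `q` centers (`(j, none)`)
pairwise adjacent. -/
def Spq (p q : ℕ) : SimpleGraph (Fin q × Option (Fin p)) :=
  SimpleGraph.fromRel (fun x y => x.2 = none ∧ (y.2 = none ∨ x.1 = y.1))

/-- `S₂(p₁,q₁,…,p_m,q_m)`: for each `i`, `q i` copies of the star `K_{1, p i}`,
with all star centers pairwise adjacent. -/
def S2g {m : ℕ} (p q : Fin m → ℕ) :
    SimpleGraph (Σ i : Fin m, Fin (q i) × Option (Fin (p i))) :=
  SimpleGraph.fromRel (fun x y =>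
    x.2.2 = none ∧ (y.2.2 = none ∨ (x.1 = y.1 ∧ (x.2.1 : ℕ) = (y.2.1 : ℕ))))

/-- `S₃(p,q₁,q₂)`: `S(p,q₁)` and `S(p+1,q₂)` with all star centers pairwise adjacent,
plus a vertex `e` (`none`) adjacent exactly to the `q₁` centers of the stars of `S(p,q₁)`. -/
def S3g (p q₁ q₂ : ℕ) :
    SimpleGraph (Option ((Fin q₁ × Option (Fin p)) ⊕ (Fin q₂ × Option (Fin (p+1))))) :=
  SimpleGraph.fromRel (fun x y =>
    match x, y with
    | some (.inl a), some (.inl b) => a.2 = none ∧ (b.2 = none ∨ a.1 = b.1)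
    | some (.inl a), some (.inr b) => a.2 = none ∧ b.2 = none
    | some (.inr a), some (.inl b) => a.2 = none ∧ b.2 = none
    | some (.inr a), some (.inr b) => a.2 = none ∧ (b.2 = none ∨ a.1 = b.1)
    | none, some (.inl a) => a.2 = none
    | _, _ => False)

/-- `S₄(p,q)`: `S₃(p,2,q)` together with a vertex `f` (`none`) adjacent to all vertices
of `S₃(p,2,q)` except `e` (`some none`). -/
def S4g (p q : ℕ) :
    SimpleGraph (Option (Option ((Fin 2 × Option (Fin p)) ⊕ (Fin q × Option (Fin (p+1)))))) :=
  SimpleGraph.fromRel (fun x y =>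
    match x, y with
    | some a, some b => (S3g p 2 q).Adj a b
    | none, some (some _) => True
    | _, _ => False)

/-- The inverse `G^I` of a split graph `G` with KS-partition `(A,B)`: delete all edges
inside `A` and add all edges inside `B`. -/
def inverse {V : Type} (G : SimpleGraph V) (A B : Set V) : SimpleGraph V :=
  SimpleGraph.fromRel (fun x y => (G.Adj x y ∧ ¬(x ∈ A ∧ y ∈ A)) ∨ (x ∈ B ∧ y ∈ B))

variable {V : Type}


/-- `S` is a fixing set of `G`: the only automorphism fixing `S` pointwise is the identity. -/
def IsFixingSet (G : SimpleGraph V) (S : Set V) : Prop :=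
  ∀ π : G ≃g G, (∀ v ∈ S, π v = v) → ∀ v, π v = v

/-- The fixing number of `G`: the least size of a fixing set. -/
noncomputable def fixingNumber (G : SimpleGraph V) : ℕ :=
  sInf {n | ∃ S : Set V, S.ncard = n ∧ IsFixingSet G S}

/-- `φ` is a distinguishing labeling of `G`: the only automorphism preserving `φ`
is the identity. -/
def IsDistinguishing {C : Type*} (G : SimpleGraph V) (φ : V → C) : Prop :=
  ∀ π : G ≃g G, (∀ v, φ (π v) = φ v) → ∀ v, π v = v

/-- The distinguishing number of `G`: the least number of colors in a distinguishing
labeling. -/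
noncomputable def distinguishingNumber (G : SimpleGraph V) : ℕ :=
  sInf {r | ∃ φ : V → Fin r, IsDistinguishing G φ}

/-- The minimum size of a vertex cover of `G`. -/
noncomputable def vcNum (G : SimpleGraph V) : ℕ :=
  sInf {n | ∃ S : Set V, S.ncard = n ∧ ∀ ⦃u v⦄, G.Adj u v → u ∈ S ∨ v ∈ S}


theorem fixingNumber_le_card {ι : Type} [Fintype ι] {G : SimpleGraph V} (f : ι → V)
    (hf : IsFixingSet G (Set.range f)) : fixingNumber G ≤ Fintype.card ι := by
  refine (Nat.sInf_le ⟨Set.range f, rfl, hf⟩ : fixingNumber G ≤ (Set.range f).ncard).trans ?_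
  rw [← Set.image_univ, ← Nat.card_eq_fintype_card, ← Set.ncard_univ]
  exact Set.ncard_image_le

theorem le_fixingNumber {G : SimpleGraph V} {n : ℕ}
    (h : ∀ S : Set V, IsFixingSet G S → n ≤ S.ncard) : n ≤ fixingNumber G := by
  refine le_csInf ⟨_, Set.univ, rfl, fun π hπ v => hπ v trivial⟩ ?_
  rintro _ ⟨S, rfl, hS⟩
  exact h S hS

/-- Transposing two twins (vertices with the same neighbors apart from each other) is an
automorphism. -/
def swapTwins [DecidableEq V] {G : SimpleGraph V} {u v : V}
    (h : ∀ w, w ≠ u → w ≠ v → (G.Adj u w ↔ G.Adj v w)) : G ≃g G where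
  toEquiv := Equiv.swap u v
  map_rel_iff' {a b} := by
    have h' : ∀ w, w ≠ u → w ≠ v → (G.Adj w u ↔ G.Adj w v) := fun w hu hv => by
      simpa only [G.adj_comm] using h w hu hv
    have hs := G.adj_comm u v
    have hl := fun w => G.loopless.irrefl w
    simp only [Equiv.swap_apply_def]
    grind

/-- If the fibers of `f : V → W` consist of twins, then a fixing set misses at most one vertex
of each fiber. -/
theorem card_sub_card_le_fixingNumber {W : Type} [Fintype V] [Fintype W] {G : SimpleGraph V}
    (f : V → W)
    (hf : ∀ u v, f u = f v → ∀ w, w ≠ u → w ≠ v → (G.Adj u w ↔ G.Adj v w)) :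
    Fintype.card V - Fintype.card W ≤ fixingNumber G := by
  classical
  refine le_fixingNumber fun S hS => ?_
  have hinj : Set.InjOn f Sᶜ := by
    intro u hu v hv huv
    have := hS (swapTwins (hf u v huv)) (fun w hw => Equiv.swap_apply_of_ne_of_ne
      (fun e => hu (e ▸ hw)) (fun e => hv (e ▸ hw))) u
    exact ((Equiv.swap_apply_left u v).symm.trans this).symm
  have h1 := Set.ncard_le_ncard_of_injOn (t := Set.univ) f (fun _ _ => trivial) hinj
  have h2 := Set.ncard_add_ncard_compl S
  rw [Set.ncard_univ] at h1
  rw [← Nat.card_eq_fintype_card, ← Nat.card_eq_fintype_card]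
  omega

/-- A permutation fixing all points but possibly one is the identity. -/
theorem apply_eq_self_of_forall_ne {π : V → V} (hπ : Function.Injective π) (w : V)
    (h : ∀ v, v ≠ w → π v = v) (v : V) : π v = v := by
  by_cases hv : v = w
  · subst hv
    by_contra hne
    exact hne (hπ (h _ hne))
  · exact h v hv

theorem fixingNumber_C5 : fixingNumber C5 = 2 := by
  have hadj : ∀ x y : ZMod 5, C5.Adj x y ↔ x ≠ y ∧ (y = x + 1 ∨ x = y + 1) := fun x y => by
    simp [C5, SimpleGraph.fromRel_adj]
  apply le_antisymm
  · refine fixingNumber_le_card (ι := Fin 2) ![0, 1] fun π hπ => ?_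
    have h0 : π 0 = 0 := hπ 0 ⟨0, rfl⟩
    have h1 : π 1 = 1 := hπ 1 ⟨1, rfl⟩
    have step : ∀ x, π x = x → π (x + 1) = x + 1 → π (x + 1 + 1) = x + 1 + 1 := by
      intro x hx hx1
      have ha : C5.Adj (x + 1) (π (x + 1 + 1)) := by
        rw [← hx1, π.map_adj_iff, hx1, hadj]
        exact ⟨by clear * -; revert x; decide, Or.inl rfl⟩
      rcases ((hadj _ _).1 ha).2 with h | h
      · exact h
      · have := π.injective (hx.trans (add_right_cancel h))
        exact absurd this (by clear * -; revert x; decide)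
    have h2 := step 0 h0 h1
    have h3 := step 1 h1 h2
    have h4 := step 2 h2 h3
    intro v
    fin_cases v <;> assumption
  · refine le_fixingNumber fun S hS => ?_
    by_contra! hlt
    obtain ⟨v, hv⟩ : ∃ v, S ⊆ {v} := (Set.ncard_le_one_iff_subset_singleton).1 (by omega)
    let π : C5 ≃g C5 :=
      { toEquiv := Equiv.subLeft (2 * v)
        map_rel_iff' := by
          intro a b
          simp only [hadj, Equiv.subLeft_apply]
          clear * -
          revert v a b
          decide }
    have h : 2 * v - (v + 1) = v + 1 := hS π (fun w hw => by
      have : w = v := hv hw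
      subst this
      change 2 * w - w = w
      ring) (v + 1)
    revert h
    clear * -
    revert v
    decide

theorem fixingNumber_mK2 (m : ℕ) : fixingNumber (mK2 m) = m := by
  apply le_antisymm
  · refine (fixingNumber_le_card (fun i : Fin m => (i, (0 : Fin 2))) fun π hπ => ?_).trans
      (by simp)
    have h0 : ∀ i, π (i, 0) = (i, 0) := fun i => hπ _ ⟨i, rfl⟩
    have h1 : ∀ i, π (i, 1) = (i, 1) := fun i => by
      have ha : (mK2 m).Adj (π (i, 0)) (π (i, 1)) := π.map_adj_iff.2 (by simp [mK2])
      rw [h0] at ha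
      generalize π (i, 1) = y at ha ⊢
      obtain ⟨j, b⟩ := y
      fin_cases b <;> simp_all [mK2] <;> grind
    rintro ⟨i, b⟩
    fin_cases b
    exacts [h0 i, h1 i]
  · refine le_trans (by simp; omega) (card_sub_card_le_fixingNumber (G := mK2 m) Prod.fst ?_)
    intro u v h w hu hv
    simp only [mK2, SimpleGraph.fromRel_adj]
    grind

theorem fixingNumber_U2 (m ℓ : ℕ) (hℓ : 2 ≤ ℓ) : fixingNumber (U2 m ℓ) = m + ℓ - 1 := by
  obtain ⟨k, rfl⟩ : ∃ k, ℓ = k + 1 + 1 := ⟨ℓ - 2, by omega⟩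
  apply le_antisymm
  · refine (fixingNumber_le_card (Sum.map (fun i : Fin m => (i, (0 : Fin 2)))
      (fun j : Fin (k + 1) => some j.succ)) fun π hπ => ?_).trans (by simp)
    have h0 : ∀ i, π (.inl (i, 0)) = .inl (i, 0) := fun i => hπ _ ⟨.inl i, rfl⟩
    have hs : ∀ j : Fin (k + 1), π (.inr (some j.succ)) = .inr (some j.succ) :=
      fun j => hπ _ ⟨.inr j, rfl⟩
    have h1 : ∀ i, π (.inl (i, 1)) = .inl (i, 1) := fun i => by
      have ha : (U2 m (k + 1 + 1)).Adj (π (.inl (i, 0))) (π (.inl (i, 1))) :=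
        π.map_adj_iff.2 (by simp [U2])
      rw [h0] at ha
      generalize π (.inl (i, 1)) = y at ha ⊢
      obtain ⟨j, b⟩ | y := y
      · fin_cases b <;> simp_all [U2] <;> grind
      · simp [U2] at ha
    have hc : π (.inr none) = .inr none := by
      have ha : (U2 m (k + 1 + 1)).Adj (π (.inr (some (Fin.succ 0)))) (π (.inr none)) :=
        π.map_adj_iff.2 (by simp [U2])
      rw [hs] at ha
      generalize π (.inr none) = y at ha ⊢
      obtain y | y := y <;> simp_all [U2]
    refine apply_eq_self_of_forall_ne π.injective (.inr (some 0)) ?_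
    rintro (⟨i, b⟩ | _ | j) hne
    · fin_cases b
      exacts [h0 i, h1 i]
    · exact hc
    · cases j using Fin.cases with
      | zero => exact absurd rfl hne
      | succ j => exact hs j
  · refine le_trans (by simp; omega) (card_sub_card_le_fixingNumber (G := U2 m (k + 1 + 1))
      (Sum.map Prod.fst (Option.map fun _ => ())) ?_)
    rintro (⟨i, a⟩ | _ | i) (⟨j, b⟩ | _ | j) h (⟨l, c⟩ | _ | l) hu hv <;>
      simp [U2, SimpleGraph.fromRel_adj] at * <;> grind

theorem fixingNumber_U3 (m : ℕ) (hm : 1 ≤ m) : fixingNumber (U3 m) = m + 1 := by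
  apply le_antisymm
  · refine (fixingNumber_le_card (fun x : Option (Fin m) =>
      (some (x.elim (.inr 0) fun i => .inl (i, 0)) : Option ((Fin m × Fin 2) ⊕ Fin 3)))
      fun π hπ => ?_).trans (by simp)
    have h0 : ∀ i, π (some (.inl (i, 0))) = some (.inl (i, 0)) := fun i => hπ _ ⟨some i, rfl⟩
    have hp0 : π (some (.inr 0)) = some (.inr 0) := hπ _ ⟨none, rfl⟩
    have hc : π none = none := by
      have ha : (U3 m).Adj (π (some (.inr 0))) (π none) := π.map_adj_iff.2 (by simp [U3])
      have hb : (U3 m).Adj (π (some (.inl (⟨0, hm⟩, 0)))) (π none) :=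
        π.map_adj_iff.2 (by simp [U3])
      rw [hp0] at ha
      rw [h0] at hb
      generalize π none = y at ha hb ⊢
      obtain _ | ⟨j, b⟩ | y := y <;> simp [U3, SimpleGraph.fromRel_adj] at ha hb ⊢
    have h1 : ∀ i, π (some (.inl (i, 1))) = some (.inl (i, 1)) := fun i => by
      have ha : (U3 m).Adj (π (some (.inl (i, 0)))) (π (some (.inl (i, 1)))) :=
        π.map_adj_iff.2 (by simp [U3])
      have hne : π (some (.inl (i, 1))) ≠ none := fun h => by
        simpa using π.injective (h.trans hc.symm)
      rw [h0] at ha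
      generalize π (some (.inl (i, 1))) = y at ha hne ⊢
      obtain _ | ⟨j, b⟩ | y := y <;> simp [U3, SimpleGraph.fromRel_adj] at ha hne ⊢
      grind
    have hp1 : π (some (.inr 1)) = some (.inr 1) := by
      have ha : (U3 m).Adj (π (some (.inr 0))) (π (some (.inr 1))) :=
        π.map_adj_iff.2 (by simp [U3])
      have hne : π (some (.inr 1)) ≠ none := fun h => by
        simpa using π.injective (h.trans hc.symm)
      rw [hp0] at ha
      generalize π (some (.inr 1)) = y at ha hne ⊢
      obtain _ | ⟨j, b⟩ | y := y <;> simp [U3, SimpleGraph.fromRel_adj] at ha hne ⊢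
      omega
    refine apply_eq_self_of_forall_ne π.injective (some (.inr 2)) ?_
    rintro (_ | ⟨i, b⟩ | j) hne
    · exact hc
    · fin_cases b
      exacts [h0 i, h1 i]
    · fin_cases j
      exacts [hp0, hp1, absurd rfl hne]
  · refine le_trans (by simp; omega) (card_sub_card_le_fixingNumber (G := U3 m)
      (Option.map (Sum.map Prod.fst fun j => decide (j = 1))) ?_)
    rintro (_ | ⟨i, a⟩ | i) (_ | ⟨j, b⟩ | j) h (_ | ⟨l, c⟩ | l) hu hv <;>
      simp [U3, SimpleGraph.fromRel_adj] at * <;> grind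

/-- The fixing numbers of the indecomposable non-split unigraphs:
`Fix(C₅) = 2`, `Fix(mK₂) = m` for `m ≥ 2`, `Fix(U₂(m,ℓ)) = m + ℓ − 1` for `m ≥ 1`,
`ℓ ≥ 2`, and `Fix(U₃(m)) = m + 1` for `m ≥ 1`. -/
theorem fixing_numbers_nonsplit :
    fixingNumber C5 = 2 ∧
    (∀ m, 2 ≤ m → fixingNumber (mK2 m) = m) ∧
    (∀ m ℓ, 1 ≤ m → 2 ≤ ℓ → fixingNumber (U2 m ℓ) = m + ℓ - 1) ∧
    (∀ m, 1 ≤ m → fixingNumber (U3 m) = m + 1) := by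
  exact ⟨fixingNumber_C5, fun m _ => fixingNumber_mK2 m, fun m ℓ _ => fixingNumber_U2 m ℓ,
    fixingNumber_U3⟩

end Tysh
end

section
/- For p ≥ 1 and q ≥ 2, the fixing number of the split graph S(p,q) is Fix(S(p,q)) = q − 1 if p = 1, and Fix(S(p,q)) = q(p − 1) if p ≥ 2. -/
namespace Tysh

open SimpleGraph

variable {V : Type}

variable {V : Type}


theorem Spq_adj {p q : ℕ} (x y : Fin q × Option (Fin p)) :
    (Spq p q).Adj x y ↔ x ≠ y ∧
      ((x.2 = none ∧ (y.2 = none ∨ x.1 = y.1)) ∨ (y.2 = none ∧ (x.2 = none ∨ y.1 = x.1))) :=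
  SimpleGraph.fromRel_adj _ _ _

theorem Spq_adj_some_iff {p q : ℕ} (j : Fin q) (i : Fin p) (y : Fin q × Option (Fin p)) :
    (Spq p q).Adj (j, some i) y ↔ y = (j, none) := by
  obtain ⟨k, _ | l⟩ := y <;> simp [Spq_adj, Prod.ext_iff]

/-- The automorphism of `S(p,q)` permuting the stars by `σ` and the leaves of star `j` by `τ j`. -/
def Spq.wreathIso {p q : ℕ} (σ : Equiv.Perm (Fin q)) (τ : Fin q → Equiv.Perm (Fin p)) :
    Spq p q ≃g Spq p q where
  toEquiv := Equiv.prodShear σ fun j => Equiv.optionCongr (τ j)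
  map_rel_iff' := by
    intro x y
    rw [Spq_adj, Spq_adj, (Equiv.injective _).ne_iff]
    simp

@[simp]
theorem Spq.wreathIso_apply {p q : ℕ} (σ : Equiv.Perm (Fin q)) (τ : Fin q → Equiv.Perm (Fin p))
    (x : Fin q × Option (Fin p)) : Spq.wreathIso σ τ x = (σ x.1, x.2.map (τ x.1)) :=
  rfl

theorem Spq_snd_eq_none_iff {p q : ℕ} (hp : 1 ≤ p) (hq : 2 ≤ q) (x : Fin q × Option (Fin p)) :
    x.2 = none ↔ ∃ u v, u ≠ v ∧ (Spq p q).Adj x u ∧ (Spq p q).Adj x v := by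
  obtain ⟨j, _ | i⟩ := x
  · have : Nontrivial (Fin q) := Fin.nontrivial_iff_two_le.2 hq
    obtain ⟨k, hk⟩ := exists_ne j
    refine iff_of_true rfl ⟨(j, some ⟨0, hp⟩), (k, none), by simp, ?_, ?_⟩
    · simp [Spq_adj]
    · simp [Spq_adj, hk.symm]
  · simp only [Spq_adj_some_iff, reduceCtorEq, false_iff]
    rintro ⟨u, v, huv, rfl, rfl⟩
    exact huv rfl

theorem Spq_iso_snd_eq_none_iff {p q : ℕ} (hp : 1 ≤ p) (hq : 2 ≤ q) (π : Spq p q ≃g Spq p q)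
    (x : Fin q × Option (Fin p)) : (π x).2 = none ↔ x.2 = none := by
  rw [Spq_snd_eq_none_iff hp hq, Spq_snd_eq_none_iff hp hq]
  constructor
  · rintro ⟨u, v, huv, hu, hv⟩
    refine ⟨π.symm u, π.symm v, π.symm.injective.ne huv, ?_, ?_⟩ <;>
      rw [← π.map_adj_iff] <;> simpa
  · rintro ⟨u, v, huv, hu, hv⟩
    exact ⟨π u, π v, π.injective.ne huv, π.map_adj_iff.2 hu, π.map_adj_iff.2 hv⟩

theorem Spq_iso_leaf {p q : ℕ} (hp : 1 ≤ p) (hq : 2 ≤ q) (π : Spq p q ≃g Spq p q) {j : Fin q}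
    (hj : π (j, none) = (j, none)) (i : Fin p) : ∃ l, π (j, some i) = (j, some l) := by
  have hne := (Spq_iso_snd_eq_none_iff hp hq π (j, some i)).not.2 (by simp)
  have hadj : (Spq p q).Adj (π (j, some i)) (π (j, none)) :=
    π.map_adj_iff.2 ((Spq_adj_some_iff _ _ _).2 rfl)
  rcases h : π (j, some i) with ⟨k, _ | l⟩
  · simp [h] at hne
  · rw [h, hj, Spq_adj_some_iff] at hadj
    exact ⟨l, by simpa using hadj.symm⟩

theorem isFixingSet_centers {q : ℕ} (hq : 1 ≤ q) :
    IsFixingSet (Spq 1 (q + 1))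
      (Set.range fun j : Fin q => ((j.succ, none) : Fin (q + 1) × Option (Fin 1))) := by
  intro π hπ
  have hcenter : ∀ j, π (j, none) = (j, none) := by
    refine Fin.cases ?_ fun j => hπ _ ⟨j, rfl⟩
    have hnone := (Spq_iso_snd_eq_none_iff le_rfl (by omega) π (0, none)).2 rfl
    rcases h : π (0, none) with ⟨k, o⟩
    obtain rfl : o = none := by simpa [h] using hnone
    cases k using Fin.cases with
    | zero => rfl
    | succ k =>
      have := π.injective (h.trans (hπ _ ⟨k, rfl⟩).symm)
      simp [Prod.ext_iff, (Fin.succ_ne_zero k).symm] at this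
  rintro ⟨j, _ | i⟩
  · exact hcenter j
  · obtain ⟨l, hl⟩ := Spq_iso_leaf le_rfl (by omega) π (hcenter j) i
    rw [hl, Subsingleton.elim l i]

theorem isFixingSet_leaves {p q : ℕ} (hp : 1 ≤ p) (hq : 2 ≤ q) :
    IsFixingSet (Spq (p + 1) q) (Set.range fun x : Fin q × Fin p =>
      ((x.1, some x.2.succ) : Fin q × Option (Fin (p + 1)))) := by
  intro π hπ
  have hleaf (j : Fin q) (i : Fin p) : π (j, some i.succ) = (j, some i.succ) := hπ _ ⟨(j, i), rfl⟩
  have hcenter (j : Fin q) : π (j, none) = (j, none) := by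
    have hadj : (Spq (p + 1) q).Adj (π (j, some (Fin.succ ⟨0, hp⟩))) (π (j, none)) :=
      π.map_adj_iff.2 ((Spq_adj_some_iff _ _ _).2 rfl)
    rwa [hleaf, Spq_adj_some_iff] at hadj
  rintro ⟨j, _ | i⟩
  · exact hcenter j
  · cases i using Fin.cases with
    | succ i => exact hleaf j i
    | zero =>
      obtain ⟨l, hl⟩ := Spq_iso_leaf (by omega) hq π (hcenter j) 0
      cases l using Fin.cases with
      | zero => exact hl
      | succ l =>
        have := π.injective (hl.trans (hleaf j l).symm)
        simp [Prod.ext_iff, (Fin.succ_ne_zero l).symm] at this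

theorem IsFixingSet.le_ncard_add_one {p q : ℕ} {S : Set (Fin q × Option (Fin p))}
    (hS : IsFixingSet (Spq p q) S) : q ≤ S.ncard + 1 := by
  classical
  have huntouched (j k : Fin q) (hj : ∀ o, (j, o) ∉ S) (hk : ∀ o, (k, o) ∉ S) : j = k := by
    have := hS (Spq.wreathIso (Equiv.swap j k) 1) (by
      rintro ⟨l, o⟩ hl
      have hlj : l ≠ j := by rintro rfl; exact hj o hl
      have hlk : l ≠ k := by rintro rfl; exact hk o hl
      simp [Equiv.swap_apply_of_ne_of_ne hlj hlk]) (j, none)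
    simpa using (congrArg Prod.fst this).symm
  let f (j : Fin q) : S ⊕ Unit :=
    if h : ∃ o, (j, o) ∈ S then .inl ⟨(j, h.choose), h.choose_spec⟩ else .inr ()
  have hf : Function.Injective f := by
    intro j k hjk
    by_cases hj : ∃ o, (j, o) ∈ S <;> by_cases hk : ∃ o, (k, o) ∈ S <;>
      simp only [f, hj, hk, dite_true, dite_false, reduceCtorEq, Sum.inl.injEq,
        Subtype.mk.injEq, Prod.mk.injEq] at hjk
    · exact hjk.1
    · exact huntouched j k (not_exists.1 hj) (not_exists.1 hk)
  have := Nat.card_le_card_of_injective f hf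
  rw [Nat.card_sum, Nat.card_coe_set_eq] at this
  simpa using this

theorem IsFixingSet.mul_le_ncard_add {p q : ℕ} {S : Set (Fin q × Option (Fin p))}
    (hS : IsFixingSet (Spq p q) S) : q * p ≤ S.ncard + q := by
  classical
  have huntouched (j : Fin q) (i l : Fin p) (hi : (j, some i) ∉ S) (hl : (j, some l) ∉ S) :
      i = l := by
    have := hS (Spq.wreathIso 1 (Function.update 1 j (Equiv.swap i l))) (by
      rintro ⟨k, _ | m⟩ hk
      · simp
      · obtain rfl | hkj := eq_or_ne k j
        · have hmi : m ≠ i := by rintro rfl; exact hi hk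
          have hml : m ≠ l := by rintro rfl; exact hl hk
          simp [Equiv.swap_apply_of_ne_of_ne hmi hml]
        · simp [hkj]) (j, some i)
    simpa using (congrArg Prod.snd this).symm
  let f (x : Fin q × Fin p) : S ⊕ Fin q :=
    if h : (x.1, some x.2) ∈ S then .inl ⟨_, h⟩ else .inr x.1
  have hf : Function.Injective f := by
    rintro ⟨j, i⟩ ⟨k, l⟩ h
    by_cases hj : (j, some i) ∈ S <;> by_cases hk : (k, some l) ∈ S <;>
      simp only [f, hj, hk, dite_true, dite_false, reduceCtorEq, Sum.inl.injEq, Sum.inr.injEq,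
        Subtype.mk.injEq, Prod.mk.injEq, Option.some.injEq] at h
    · exact Prod.ext h.1 h.2
    · subst h
      rw [huntouched j i l hj hk]
  have := Nat.card_le_card_of_injective f hf
  rw [Nat.card_sum, Nat.card_coe_set_eq] at this
  simpa using this

theorem fixingNumber_eq {G : SimpleGraph V} {n : ℕ} {S : Set V} (hS : IsFixingSet G S)
    (hcard : S.ncard = n) (hle : ∀ T, IsFixingSet G T → n ≤ T.ncard) : fixingNumber G = n := by
  refine le_antisymm (Nat.sInf_le ⟨S, hcard, hS⟩) (le_csInf ⟨n, S, hcard, hS⟩ ?_)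
  rintro _ ⟨T, rfl, hT⟩
  exact hle T hT

/-- For `p ≥ 1` and `q ≥ 2`, `Fix(S(p,q)) = q − 1` if `p = 1`, and
`Fix(S(p,q)) = q(p − 1)` if `p ≥ 2`. -/
theorem fixing_number_Spq (p q : ℕ) (hp : 1 ≤ p) (hq : 2 ≤ q) :
    (p = 1 → fixingNumber (Spq p q) = q - 1) ∧
    (2 ≤ p → fixingNumber (Spq p q) = q * (p - 1)) := by
  refine ⟨?_, fun hp2 => ?_⟩
  · rintro rfl
    obtain ⟨q, rfl⟩ := Nat.exists_eq_add_of_le' (show 1 ≤ q by omega)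
    refine fixingNumber_eq (isFixingSet_centers (by omega)) ?_ fun T hT => ?_
    · rw [Set.ncard_range_of_injective fun i j h => by simpa using h]
      simp
    · have := hT.le_ncard_add_one
      omega
  · obtain ⟨p, rfl⟩ := Nat.exists_eq_add_of_le' hp
    refine fixingNumber_eq (isFixingSet_leaves (by omega) hq) ?_ fun T hT => ?_
    · rw [Set.ncard_range_of_injective fun x y h => by simpa [Prod.ext_iff] using h]
      simp
    · have := hT.mul_le_ncard_add
      rw [mul_add_one] at this
      simpa using this

end Tysh
end

section
/- For every finite simple graph G, Fix(G) = Fix(complement of G). Moreover, if G is an indecomposable split graph with KS-partition (A,B), then Fix(G) = Fix(G^I), where G^I is the inverse of (G,A,B). -/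
namespace Tysh

open SimpleGraph

variable {V : Type}

variable {V : Type}


/-- `w` is a swing vertex for `(A, B)`: it is adjacent to every other vertex of `A` and to no
vertex of `B`. -/
def IsSwing (G : SimpleGraph V) (A B : Set V) (w : V) : Prop :=
  (∀ a ∈ A, a ≠ w → G.Adj w a) ∧ ∀ b ∈ B, ¬ G.Adj w b

theorem IsKSPartition.mem_or {G : SimpleGraph V} {A B : Set V} (h : IsKSPartition G A B) (v : V) :
    v ∈ A ∨ v ∈ B := by
  have hv : v ∈ A ∪ B := h.2.2.1 ▸ Set.mem_univ v
  exact hv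

theorem IsKSPartition.notMem_of_mem {G : SimpleGraph V} {A B : Set V} (h : IsKSPartition G A B)
    {v : V} (hv : v ∈ A) : v ∉ B :=
  Set.disjoint_left.mp h.2.2.2 hv

theorem IsKSPartition.preimage {G : SimpleGraph V} {A B : Set V} (h : IsKSPartition G A B)
    (π : Equiv.Perm V) (hπ : ∀ x y, G.Adj (π x) (π y) ↔ G.Adj x y) :
    IsKSPartition G (π ⁻¹' A) (π ⁻¹' B) := by
  refine ⟨fun x hx y hy hxy => (hπ x y).1 (h.1 hx hy (π.injective.ne hxy)),
    fun x hx y hy hxy hadj => h.2.1 hx hy (π.injective.ne hxy) ((hπ x y).2 hadj), ?_,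
    h.2.2.2.preimage π⟩
  rw [← Set.preimage_union, h.2.2.1, Set.preimage_univ]

/-- A graph with two distinct KS-partitions has a swing vertex. -/
theorem IsKSPartition.exists_isSwing {G : SimpleGraph V} {A B C D : Set V}
    (h : IsKSPartition G A B) (h' : IsKSPartition G C D) (hne : A ≠ C) :
    ∃ w, IsSwing G A B w := by
  have hAB := h.mem_or
  have hCD := h'.mem_or
  have hA : ∀ u v, u ∈ A → v ∈ A → u ≠ v → G.Adj u v := fun u v hu hv => h.1 hu hv
  have hB : ∀ u v, u ∈ B → v ∈ B → ¬ G.Adj u v := fun u v hu hv hadj =>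
    h.2.1 hu hv hadj.ne hadj
  have hC : ∀ u v, u ∈ C → v ∈ C → u ≠ v → G.Adj u v := fun u v hu hv => h'.1 hu hv
  have hD : ∀ u v, u ∈ D → v ∈ D → ¬ G.Adj u v := fun u v hu hv hadj =>
    h'.2.1 hu hv hadj.ne hadj
  have hdis : ∀ v ∈ A, v ∉ B := fun v => h.notMem_of_mem
  have hdis' : ∀ v ∈ C, v ∉ D := fun v => h'.notMem_of_mem
  unfold IsSwing
  by_cases hx : ∃ x ∈ A, x ∈ D
  · obtain ⟨x, hxA, hxD⟩ := hx
    by_cases hy : ∃ y ∈ B, y ∈ C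
    · obtain ⟨y, hyB, hyC⟩ := hy
      by_cases hxy : G.Adj y x
      · refine ⟨y, fun a ha hay => ?_, fun b hb => hB y b hyB hb⟩
        by_cases hax : a = x
        · exact hax ▸ hxy
        · have haC : a ∈ C := (hCD a).resolve_right fun haD => hD a x haD hxD (hA a x ha hxA hax)
          exact hC y a hyC haC hay.symm
      · refine ⟨x, fun a ha hax => hA x a hxA ha hax.symm, fun b hb hadj => ?_⟩
        by_cases hby : b = y
        · exact hxy (hby ▸ hadj.symm)
        · have hbD : b ∈ D := (hCD b).resolve_left fun hbC => hB b y hb hyB (hC b y hbC hyC hby)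
          exact hD x b hxD hbD hadj
    · refine ⟨x, fun a ha hax => hA x a hxA ha hax.symm, fun b hb => hD x b hxD ?_⟩
      exact (hCD b).resolve_left fun hbC => hy ⟨b, hb, hbC⟩
  · have hAC : A ⊆ C := fun a ha => (hCD a).resolve_right fun haD => hx ⟨a, ha, haD⟩
    obtain ⟨y, hyC, hyA⟩ := Set.not_subset.1 fun hCA => hne (hAC.antisymm hCA)
    have hyB := (hAB y).resolve_left hyA
    exact ⟨y, fun a ha hay => hC y a hyC (hAC ha) hay.symm, fun b hb => hB y b hyB hb⟩

theorem IsKSPartition.decomposable_of_isSwing [Nontrivial V] {G : SimpleGraph V} {A B : Set V}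
    (h : IsKSPartition G A B) {w : V} (hw : IsSwing G A B w) : Decomposable G := by
  refine ⟨A \ {w}, B \ {w}, {w}, ?_, h.2.2.2.mono Set.sdiff_subset Set.sdiff_subset, ?_, ?_,
    Set.singleton_nonempty w, h.1.subset Set.sdiff_subset,
    fun u hu v hv => h.2.1 hu.1 hv.1, ?_, ?_⟩
  · rw [← Set.union_sdiff_distrib, h.2.2.1, Set.sdiff_union_self, Set.univ_union]
  · rw [← Set.union_sdiff_distrib]
    exact Set.disjoint_sdiff_left
  · obtain ⟨v, hv⟩ := exists_ne w
    exact ⟨v, (h.mem_or v).imp (⟨·, hv⟩) (⟨·, hv⟩)⟩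
  · rintro a ⟨ha, haw⟩ _ rfl
    exact (hw.1 a ha haw).symm
  · rintro b ⟨hb, -⟩ _ rfl hadj
    exact hw.2 b hb hadj.symm

theorem decomposable_of_forall_adj [Nontrivial V] {G : SimpleGraph V} {w : V}
    (hw : ∀ v, v ≠ w → G.Adj w v) : Decomposable G := by
  refine ⟨{w}, ∅, {w}ᶜ, by simp, by simp, ?_, by simp, exists_ne w, by simp,
    fun u hu => hu.elim, ?_, fun b hb => hb.elim⟩
  · rw [Set.union_empty]
    exact disjoint_compl_right
  · rintro _ rfl v hv
    exact hw v hv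

theorem decomposable_of_forall_not_adj [Nontrivial V] {G : SimpleGraph V} {w : V}
    (hw : ∀ v, ¬ G.Adj w v) : Decomposable G := by
  refine ⟨∅, {w}, {w}ᶜ, by simp, by simp, ?_, by simp, exists_ne w, by simp, ?_,
    fun a ha => ha.elim, ?_⟩
  · rw [Set.empty_union]
    exact disjoint_compl_right
  · rintro _ rfl v _ _
    exact hw v
  · rintro _ rfl v _
    exact hw v

open scoped Classical in
theorem IsKSPartition.inverse_adj {G : SimpleGraph V} {A B : Set V} (h : IsKSPartition G A B)
    (x y : V) : (inverse G A B).Adj x y ↔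
      x ≠ y ∧ if x ∈ A ↔ y ∈ A then x ∉ A else G.Adj x y := by
  have hx := h.mem_or x
  have hy := h.mem_or y
  have hx' := h.notMem_of_mem (v := x)
  have hy' := h.notMem_of_mem (v := y)
  have hB : x ∈ B → y ∈ B → x ≠ y → ¬ G.Adj x y := fun hxB hyB => h.2.1 hxB hyB
  have hsymm := G.adj_comm x y
  simp only [inverse, SimpleGraph.fromRel_adj]
  grind

open scoped Classical in
theorem IsKSPartition.adj_iff {G : SimpleGraph V} {A B : Set V} (h : IsKSPartition G A B)
    (x y : V) : G.Adj x y ↔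
      x ≠ y ∧ if x ∈ A ↔ y ∈ A then x ∈ A else (inverse G A B).Adj x y := by
  have hx := h.mem_or x
  have hy := h.mem_or y
  have hA : x ∈ A → y ∈ A → x ≠ y → G.Adj x y := fun hxA hyA => h.1 hxA hyA
  have hB : x ∈ B → y ∈ B → x ≠ y → ¬ G.Adj x y := fun hxB hyB => h.2.1 hxB hyB
  have hne : G.Adj x y → x ≠ y := SimpleGraph.Adj.ne
  rw [h.inverse_adj]
  grind

theorem IsKSPartition.inverse {G : SimpleGraph V} {A B : Set V} (h : IsKSPartition G A B) :
    IsKSPartition (inverse G A B) B A := by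
  refine ⟨fun x hx y hy hxy => ?_, fun x hx y hy hxy => ?_, by rw [Set.union_comm, h.2.2.1],
    h.2.2.2.symm⟩
  · have hxA : x ∉ A := fun hxA => h.notMem_of_mem hxA hx
    have hyA : y ∉ A := fun hyA => h.notMem_of_mem hyA hy
    simp [h.inverse_adj, hxy, hxA, hyA]
  · simp [h.inverse_adj, hx, hy]

/-- A swing vertex of the inverse is dominating or isolated in the original graph. -/
theorem IsKSPartition.decomposable_of_isSwing_inverse [Nontrivial V] {G : SimpleGraph V}
    {A B : Set V} (h : IsKSPartition G A B) {w : V}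
    (hw : IsSwing (Tysh.inverse G A B) B A w) : Decomposable G := by
  by_cases hwA : w ∈ A
  · refine decomposable_of_forall_adj (w := w) fun v hv => (h.adj_iff w v).2 ⟨hv.symm, ?_⟩
    by_cases hvA : v ∈ A
    · simp [hwA, hvA]
    · simpa [hwA, hvA] using hw.1 v ((h.mem_or v).resolve_left hvA) hv
  · refine decomposable_of_forall_not_adj (w := w) fun v hadj => ?_
    have hwv := (h.adj_iff w v).1 hadj
    by_cases hvA : v ∈ A
    · exact hw.2 v hvA (by simpa [hwA, hvA] using hwv.2)
    · simp [hwA, hvA] at hwv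

/-- An automorphism of a split graph without swing vertices preserves the KS-partition. -/
theorem IsKSPartition.map_mem_iff {G : SimpleGraph V} {A B : Set V} (h : IsKSPartition G A B)
    (hs : Nontrivial V → ∀ w, ¬ IsSwing G A B w) (π : Equiv.Perm V)
    (hπ : ∀ x y, G.Adj (π x) (π y) ↔ G.Adj x y) (v : V) : π v ∈ A ↔ v ∈ A := by
  rcases subsingleton_or_nontrivial V with hV | hV
  · rw [Subsingleton.elim (π v) v]
  · by_contra hv
    obtain ⟨w, hw⟩ := h.exists_isSwing (h.preimage π hπ) fun heq =>
      hv (Set.ext_iff.1 heq v).symm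
    exact hs hV w hw

theorem isFixingSet_iff (G : SimpleGraph V) (S : Set V) :
    IsFixingSet G S ↔ ∀ π : Equiv.Perm V, (∀ x y, G.Adj (π x) (π y) ↔ G.Adj x y) →
      (∀ v ∈ S, π v = v) → ∀ v, π v = v :=
  ⟨fun h π hπ => h ⟨π, hπ _ _⟩, fun h π => h π.toEquiv fun _ _ => π.map_rel_iff⟩

/-- Graphs with the same automorphisms have the same fixing number. -/
theorem fixingNumber_congr {G H : SimpleGraph V}
    (h : ∀ π : Equiv.Perm V, (∀ x y, G.Adj (π x) (π y) ↔ G.Adj x y) ↔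
      ∀ x y, H.Adj (π x) (π y) ↔ H.Adj x y) :
    fixingNumber G = fixingNumber H := by
  simp only [fixingNumber, isFixingSet_iff, h]

/-- For every graph `G`, `Fix(G) = Fix(Gᶜ)`; and if `G` is an indecomposable split graph
with KS-partition `(A,B)`, then `Fix(G) = Fix(G^I)`. -/
theorem fixing_complement_inverse {V : Type} [Fintype V] (G : SimpleGraph V) :
    fixingNumber G = fixingNumber Gᶜ ∧
    (∀ A B, IsKSPartition G A B → ¬ Decomposable G →
      fixingNumber G = fixingNumber (inverse G A B)) := by
  refine ⟨fixingNumber_congr fun π => ?_, fun A B h hG => fixingNumber_congr fun π => ?_⟩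
  · refine forall₂_congr fun x y => ?_
    by_cases hxy : x = y
    · simp [hxy]
    · simp [SimpleGraph.compl_adj, hxy, not_iff_not]
  · constructor
    · intro hπ x y
      have hA := h.map_mem_iff (fun _ w hw => hG (h.decomposable_of_isSwing hw)) π hπ
      by_cases hx : x ∈ A <;> by_cases hy : y ∈ A <;> simp [h.inverse_adj, hA, hπ, hx, hy]
    · intro hπ x y
      have hB := h.inverse.map_mem_iff
        (fun _ w hw => hG (h.decomposable_of_isSwing_inverse hw)) π hπ
      have hA : ∀ v, π v ∈ A ↔ v ∈ A := fun v => by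
        have hmem : ∀ u, u ∈ A ↔ u ∉ B := fun u =>
          ⟨h.notMem_of_mem, (h.mem_or u).resolve_right⟩
        rw [hmem, hmem, hB]
      rw [h.adj_iff, h.adj_iff x y]
      by_cases hx : x ∈ A <;> by_cases hy : y ∈ A <;> simp [hA, hπ, hx, hy]

end Tysh
end
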